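/- Let V^{ATS} denote the optimal objective value of the adaptive two-stage capacity expansion problem in which the revision times are themselves optimized, i.e., V^{ATS} = min over revision vectors t of V^{ATS}(t). Then for any revision vector t* = (t_1*,…,t_I*), V^{ATS}(t*) − V^{ATS} ≤ Σ_{i=1}^I ( v_i^R(t_i*) − v_i^M + max_{n ∈ 𝒯_i(t_i*)} { ⌈δ_{in}⌉ − δ_{in} } · a_{i1} ), where δ_{in} = [A_n y_n^{MLP}]_i with {y_n^{MLP}}_{n∈𝒯} the optimal capacity allocation decisions of the LP relaxation of the multi-stage problem, and v_i^M, v_i^R(t_i*) are the optimal values of the LP relaxations of the single-resource multi-stage and adaptive two-stage problems with demands δ_{in}. -/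

import Mathlib

open scoped Classical

noncomputable section

/-- A scenario tree with `T` stages over a finite node type: a finite rooted tree whose
nodes are partitioned into stages `1, …, T` (the root being the unique stage-1 node),
equipped with strictly positive node probabilities summing to one within each stage and
with each internal node's probability equal to the sum of its children's probabilities. -/
structure ScenarioTree (T : ℕ) (Node : Type) [Fintype Node] [DecidableEq Node] where
  root : Node
  parent : Node → Node
  stage : Node → ℕ
  stage_root : stage root = 1
  stage_pos : ∀ n, 1 ≤ stage n
  stage_le : ∀ n, stage n ≤ T
  root_unique : ∀ n, stage n = 1 → n = root
  parent_root : parent root = root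
  parent_stage : ∀ n, n ≠ root → stage (parent n) + 1 = stage n
  reaches_root : ∀ n, ∃ k : ℕ, parent^[k] n = root
  prob : Node → ℝ
  prob_pos : ∀ n, 0 < prob n
  prob_sum_stage : ∀ t, 1 ≤ t → t ≤ T →
    ∑ n ∈ Finset.univ.filter (fun n => stage n = t), prob n = 1
  prob_children : ∀ n, stage n < T →
    prob n = ∑ m ∈ Finset.univ.filter (fun m => m ≠ root ∧ parent m = n), prob m

namespace ScenarioTree

variable {T : ℕ} {Node : Type} [Fintype Node] [DecidableEq Node]

/-- `m` lies on the unique path from the root to `n` (i.e. `m` is an ancestor of `n`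
or `n` itself); equivalently, `n` belongs to the subtree `𝒯(m)` rooted at `m`. -/
def onPath (tr : ScenarioTree T Node) (m n : Node) : Prop :=
  ∃ k : ℕ, tr.parent^[k] n = m

/-- `P(n)`: the set of nodes on the unique path from the root to `n` (inclusive). -/
def pathSet (tr : ScenarioTree T Node) (n : Node) : Finset Node :=
  Finset.univ.filter fun m => tr.onPath m n

/-- `S_t`: the set of nodes in stage `t`. -/
def stageSet (tr : ScenarioTree T Node) (t : ℕ) : Finset Node :=
  Finset.univ.filter fun n => tr.stage n = t

/-- Objective `∑_{n ∈ 𝒯} p_n a_n x_n` of the single-resource capacity expansion LP. -/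
def lpObj (tr : ScenarioTree T Node) (a x : Node → ℝ) : ℝ :=
  ∑ n, tr.prob n * a n * x n

/-- Feasibility for the single-resource capacity expansion LP:
`x ≥ 0` and `∑_{m ∈ P(n)} x_m ≥ δ_n` for all nodes `n`. -/
def lpFeas (tr : ScenarioTree T Node) (δ x : Node → ℝ) : Prop :=
  (∀ n, 0 ≤ x n) ∧ ∀ n, δ n ≤ ∑ m ∈ tr.pathSet n, x m

/-- Two-stage constraint: `x_m = x_n` for all `m, n` in the same stage. -/
def twoStageConstr (tr : ScenarioTree T Node) (x : Node → ℝ) : Prop :=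
  ∀ m n, tr.stage m = tr.stage n → x m = x n

/-- Adaptive two-stage constraint with revision time `t*`: `x_m = x_n` for all
`m, n ∈ S_t` with `t < t*`, and `x_m = x_n` for all `m, n ∈ S_t ∩ 𝒯(j)` for each
`j ∈ S_{t*}` and each `t ≥ t*`. -/
def adaptiveConstr (tr : ScenarioTree T Node) (tstar : ℕ) (x : Node → ℝ) : Prop :=
  (∀ m n, tr.stage m = tr.stage n → tr.stage m < tstar → x m = x n) ∧
  (∀ j, tr.stage j = tstar → ∀ m n, tr.onPath j m → tr.onPath j n →
    tr.stage m = tr.stage n → x m = x n)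

/-- `v^M`: optimal value of the multi-stage LP. -/
def vM (tr : ScenarioTree T Node) (a δ : Node → ℝ) : ℝ :=
  sInf (tr.lpObj a '' {x | tr.lpFeas δ x})

/-- `v^T`: optimal value of the two-stage LP. -/
def vT (tr : ScenarioTree T Node) (a δ : Node → ℝ) : ℝ :=
  sInf (tr.lpObj a '' {x | tr.lpFeas δ x ∧ tr.twoStageConstr x})

/-- `v^R(t*)`: optimal value of the adaptive two-stage LP with revision time `t*`. -/
def vR (tr : ScenarioTree T Node) (a δ : Node → ℝ) (tstar : ℕ) : ℝ :=
  sInf (tr.lpObj a '' {x | tr.lpFeas δ x ∧ tr.adaptiveConstr tstar x})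

/-- `a_* = min_{n∈𝒯} a_n`. -/
def aMin (tr : ScenarioTree T Node) (a : Node → ℝ) : ℝ := sInf (Set.range a)

/-- `a^* = max_{n∈𝒯} a_n`. -/
def aMax (tr : ScenarioTree T Node) (a : Node → ℝ) : ℝ := sSup (Set.range a)

/-- `δ* = max_{n∈𝒯} δ_n`. -/
def deltaMax (tr : ScenarioTree T Node) (δ : Node → ℝ) : ℝ := sSup (Set.range δ)

/-- `a̲^−(t*) = min{a_n : t_n < t*}`. -/
def aMinusLo (tr : ScenarioTree T Node) (a : Node → ℝ) (tstar : ℕ) : ℝ :=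
  sInf (a '' {n | tr.stage n < tstar})

/-- `a̲^+(t*) = min{a_n : t_n ≥ t*}`. -/
def aPlusLo (tr : ScenarioTree T Node) (a : Node → ℝ) (tstar : ℕ) : ℝ :=
  sInf (a '' {n | tstar ≤ tr.stage n})

/-- `ā^−(t*) = max{a_n : t_n < t*}`. -/
def aMinusHi (tr : ScenarioTree T Node) (a : Node → ℝ) (tstar : ℕ) : ℝ :=
  sSup (a '' {n | tr.stage n < tstar})

/-- `ā^+(t*) = max{a_n : t_n ≥ t*}`. -/
def aPlusHi (tr : ScenarioTree T Node) (a : Node → ℝ) (tstar : ℕ) : ℝ :=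
  sSup (a '' {n | tstar ≤ tr.stage n})

/-- `δ^−(t*) = max_{m ∈ 𝒯(1, t*−1)} δ_m`, the maximum demand before the revision time. -/
def deltaMinus (tr : ScenarioTree T Node) (δ : Node → ℝ) (tstar : ℕ) : ℝ :=
  sSup (δ '' {m | tr.stage m < tstar})

/-- `δ^+(t*) = ∑_{n ∈ S_{t*}} p_n · max_{m ∈ 𝒯(1, t*−1) ∪ 𝒯(n)} δ_m`. -/
def deltaPlus (tr : ScenarioTree T Node) (δ : Node → ℝ) (tstar : ℕ) : ℝ :=
  ∑ n ∈ tr.stageSet tstar, tr.prob n *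
    sSup (δ '' {m | tr.stage m < tstar ∨ tr.onPath n m})

/-- `δ̄ = ∑_{n ∈ S_T} p_n · max_{m ∈ P(n)} δ_m`, the expected maximum demand over scenarios. -/
def deltaBar (tr : ScenarioTree T Node) (δ : Node → ℝ) : ℝ :=
  ∑ n ∈ tr.stageSet T, tr.prob n * sSup (δ '' {m | tr.onPath m n})

end ScenarioTree


section CapacityExpansion

variable {T : ℕ} {Node : Type} [Fintype Node] [DecidableEq Node]
variable {I J K : ℕ}

/-- Objective `∑_{n∈𝒯} p_n (a_n^⊤ x_n + b_n^⊤ y_n)` of the stochastic capacity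
expansion planning problem (`x`: capacity acquisitions, `y`: capacity allocations). -/
def capObj (tr : ScenarioTree T Node) (a : Node → Fin I → ℝ) (b : Node → Fin J → ℝ)
    (x : Node → Fin I → ℝ) (y : Node → Fin J → ℝ) : ℝ :=
  ∑ n, tr.prob n * ((∑ i, a n i * x n i) + (∑ j, b n j * y n j))

/-- Constraints of the stochastic capacity expansion planning problem (with the
integrality of `x` relaxed): `x ≥ 0`, `y ≥ 0`, `A_n y_n ≤ ∑_{m∈P(n)} x_m`, and
`B_n y_n ≥ d_n` for all nodes `n`. -/
def capFeas (tr : ScenarioTree T Node)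
    (A : Node → Matrix (Fin I) (Fin J) ℝ) (B : Node → Matrix (Fin K) (Fin J) ℝ)
    (dem : Node → Fin K → ℝ)
    (x : Node → Fin I → ℝ) (y : Node → Fin J → ℝ) : Prop :=
  (∀ n i, 0 ≤ x n i) ∧ (∀ n j, 0 ≤ y n j) ∧
  (∀ n (i : Fin I), (A n).mulVec (y n) i ≤ ∑ m ∈ tr.pathSet n, x m i) ∧
  (∀ n (k : Fin K), dem n k ≤ (B n).mulVec (y n) k)

/-- Integrality of the capacity acquisition decisions: `x_n ∈ ℤ_+^I`. -/
def capIntegral {Node : Type} (x : Node → Fin I → ℝ) : Prop :=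
  ∀ n i, ∃ z : ℕ, x n i = (z : ℝ)

/-- `V^{TS}`: optimal value of the two-stage stochastic capacity expansion problem. -/
def VTS (tr : ScenarioTree T Node) (a : Node → Fin I → ℝ) (b : Node → Fin J → ℝ)
    (A : Node → Matrix (Fin I) (Fin J) ℝ) (B : Node → Matrix (Fin K) (Fin J) ℝ)
    (dem : Node → Fin K → ℝ) : ℝ :=
  sInf {v : ℝ | ∃ x y, capFeas tr A B dem x y ∧ capIntegral x ∧
    (∀ i : Fin I, tr.twoStageConstr (fun n => x n i)) ∧ v = capObj tr a b x y}

/-- `V^{MS}`: optimal value of the multi-stage stochastic capacity expansion problem. -/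
def VMS (tr : ScenarioTree T Node) (a : Node → Fin I → ℝ) (b : Node → Fin J → ℝ)
    (A : Node → Matrix (Fin I) (Fin J) ℝ) (B : Node → Matrix (Fin K) (Fin J) ℝ)
    (dem : Node → Fin K → ℝ) : ℝ :=
  sInf {v : ℝ | ∃ x y, capFeas tr A B dem x y ∧ capIntegral x ∧ v = capObj tr a b x y}

/-- `V^{ATS}(t*)`: optimal value of the adaptive two-stage stochastic capacity
expansion problem under the given vector `t*` of revision times. -/
def VATS (tr : ScenarioTree T Node) (a : Node → Fin I → ℝ) (b : Node → Fin J → ℝ)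
    (A : Node → Matrix (Fin I) (Fin J) ℝ) (B : Node → Matrix (Fin K) (Fin J) ℝ)
    (dem : Node → Fin K → ℝ) (tstar : Fin I → ℕ) : ℝ :=
  sInf {v : ℝ | ∃ x y, capFeas tr A B dem x y ∧ capIntegral x ∧
    (∀ i : Fin I, tr.adaptiveConstr (tstar i) (fun n => x n i)) ∧ v = capObj tr a b x y}

/-- `V^{ATS}`: optimal value of the adaptive two-stage capacity expansion problem in
which the revision times themselves are optimized. -/
def VATSopt (tr : ScenarioTree T Node) (a : Node → Fin I → ℝ) (b : Node → Fin J → ℝ)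
    (A : Node → Matrix (Fin I) (Fin J) ℝ) (B : Node → Matrix (Fin K) (Fin J) ℝ)
    (dem : Node → Fin K → ℝ) : ℝ :=
  sInf {v : ℝ | ∃ tstar : Fin I → ℕ, (∀ i, 1 ≤ tstar i ∧ tstar i ≤ T) ∧
    v = VATS tr a b A B dem tstar}

/-- The merged demand values `δ̂_n = max_{m ∈ Ĉ_n} δ_m` of the condensed scenario tree
`𝒯_i(t*)`: one value for each stage `t < t*` (all stage-`t` nodes are merged) and one
value for each pair of a node `j ∈ S_{t*}` and a stage `t ≥ t*` (the nodes of
`S_t ∩ 𝒯(j)` are merged). -/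
def ScenarioTree.condensedDemands (tr : ScenarioTree T Node) (δ : Node → ℝ)
    (tstar : ℕ) : Set ℝ :=
  {v | ∃ t, 1 ≤ t ∧ t < tstar ∧ v = sSup (δ '' {m | tr.stage m = t})} ∪
  {v | ∃ j, tr.stage j = tstar ∧ ∃ t, tstar ≤ t ∧ t ≤ T ∧
    v = sSup (δ '' {m | tr.stage m = t ∧ tr.onPath j m})}

/-- `max_{n ∈ 𝒯_i(t*)} (⌈δ_{in}⌉ − δ_{in})`: the maximum integrality (ceiling) gap of
the merged demands over the condensed scenario tree. -/
def ScenarioTree.condGap (tr : ScenarioTree T Node) (δ : Node → ℝ) (tstar : ℕ) : ℝ :=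
  sSup ((fun v => (⌈v⌉ : ℝ) - v) '' tr.condensedDemands δ tstar)

end CapacityExpansion

section Helpers

open MeasureTheory

lemma floor_add_integral (X : ℝ) :
    IntegrableOn (fun θ : ℝ => ((⌊X + θ⌋ : ℤ) : ℝ)) (Set.Ico 0 1) ∧
    ∫ θ in Set.Ico (0:ℝ) 1, ((⌊X + θ⌋ : ℤ) : ℝ) = X := by
  have hf0 := Int.fract_nonneg X
  have hf1 := Int.fract_lt_one X
  have hX := Int.floor_add_fract X
  have heq : Set.EqOn (fun θ : ℝ => ((⌊X + θ⌋ : ℤ) : ℝ))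
      (fun θ => (⌊X⌋ : ℝ) + (Set.Ici (1 - Int.fract X)).indicator (fun _ => (1:ℝ)) θ)
      (Set.Ico 0 1) := by
    intro θ hθ
    obtain ⟨h0, h1⟩ := hθ
    by_cases h : 1 - Int.fract X ≤ θ
    · have : ⌊X + θ⌋ = ⌊X⌋ + 1 := by
        rw [Int.floor_eq_iff]; push_cast; constructor <;> linarith
      simp [this, Set.indicator, h]
    · have : ⌊X + θ⌋ = ⌊X⌋ := by
        push Not at h
        rw [Int.floor_eq_iff]; constructor <;> linarith
      simp only [this, Set.indicator, Set.mem_Ici, h, if_false, add_zero]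
  have hc : IntegrableOn (fun _ : ℝ => (⌊X⌋ : ℝ)) (Set.Ico 0 1) := by
    apply integrableOn_const <;> simp
  have hi : IntegrableOn (fun θ : ℝ => (Set.Ici (1 - Int.fract X)).indicator (fun _ => (1:ℝ)) θ)
      (Set.Ico 0 1) := by
    apply Integrable.indicator _ measurableSet_Ici
    have : IntegrableOn (fun _ : ℝ => (1 : ℝ)) (Set.Ico 0 1) := by
      apply integrableOn_const <;> simp
    exact this
  constructor
  · exact (integrableOn_congr_fun heq measurableSet_Ico).2 (hc.add hi)
  · rw [setIntegral_congr_fun measurableSet_Ico heq, integral_add hc hi,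
      integral_indicator_const _ measurableSet_Ici]
    have hs : Set.Ici (1 - Int.fract X) ∩ Set.Ico 0 1 = Set.Ico (1 - Int.fract X) 1 := by
      ext u
      simp only [Set.mem_inter_iff, Set.mem_Ici, Set.mem_Ico]
      constructor
      · rintro ⟨h1, h2, h3⟩; exact ⟨h1, h3⟩
      · rintro ⟨h1, h2⟩; exact ⟨h1, by linarith, h2⟩
    simp [measureReal_restrict_apply, measurableSet_Ici, hs, hf0]

lemma exists_rounding {ι : Type} [Fintype ι] (c X X' : ι → ℝ) :
    ∃ θ : ℝ, 0 ≤ θ ∧ θ < 1 ∧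
      ∑ n, c n * (((⌊X n + θ⌋ : ℤ) : ℝ) - ((⌊X' n + θ⌋ : ℤ) : ℝ)) ≤ ∑ n, c n * (X n - X' n) := by
  have hint : ∀ n, IntegrableOn (fun θ : ℝ =>
      c n * (((⌊X n + θ⌋ : ℤ) : ℝ) - ((⌊X' n + θ⌋ : ℤ) : ℝ))) (Set.Ico 0 1) := fun n =>
    ((floor_add_integral (X n)).1.sub (floor_add_integral (X' n)).1).const_mul (c n)
  have hsum : IntegrableOn (fun θ : ℝ =>
      ∑ n, c n * (((⌊X n + θ⌋ : ℤ) : ℝ) - ((⌊X' n + θ⌋ : ℤ) : ℝ))) (Set.Ico 0 1) :=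
    integrable_finset_sum _ fun n _ => hint n
  obtain ⟨θ, hθ, hle⟩ := exists_le_setAverage (μ := volume) (by simp) (by simp) hsum
  refine ⟨θ, hθ.1, hθ.2, hle.trans (le_of_eq ?_)⟩
  rw [setAverage_eq, integral_finset_sum _ (fun n _ => hint n)]
  simp only [integral_const_mul]
  simp only [integral_sub (floor_add_integral (X _)).1 (floor_add_integral (X' _)).1,
    (floor_add_integral _).2]
  simp

namespace ScenarioTree

variable {T : ℕ} {Node : Type} [Fintype Node] [DecidableEq Node]

lemma iterate_parent_root (tr : ScenarioTree T Node) (k : ℕ) :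
    tr.parent^[k] tr.root = tr.root :=
  Function.iterate_fixed tr.parent_root k

lemma onPath_parent_or (tr : ScenarioTree T Node) {m n : Node} :
    tr.onPath m n ↔ m = n ∨ tr.onPath m (tr.parent n) := by
  constructor
  · rintro ⟨k, hk⟩
    cases k with
    | zero => left; exact hk.symm
    | succ k => right; exact ⟨k, by simpa using hk⟩
  · rintro (h | ⟨k, hk⟩)
    · exact ⟨0, h.symm⟩
    · exact ⟨k + 1, by simpa using hk⟩

lemma stage_parent_le (tr : ScenarioTree T Node) (n : Node) :
    tr.stage (tr.parent n) ≤ tr.stage n := by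
  by_cases h : n = tr.root
  · rw [h, tr.parent_root]
  · have := tr.parent_stage n h; omega

lemma onPath_stage_le (tr : ScenarioTree T Node) {m n : Node} (h : tr.onPath m n) :
    tr.stage m ≤ tr.stage n := by
  obtain ⟨k, hk⟩ := h
  induction k generalizing n with
  | zero => simp at hk; rw [hk]
  | succ k ih =>
    exact (ih (by simpa using hk)).trans (tr.stage_parent_le n)

lemma pathSet_root (tr : ScenarioTree T Node) : tr.pathSet tr.root = {tr.root} := by
  ext m
  simp only [pathSet, Finset.mem_filter, Finset.mem_univ, true_and, Finset.mem_singleton]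
  constructor
  · rintro ⟨k, hk⟩; rw [← hk, iterate_parent_root]
  · rintro rfl; exact ⟨0, rfl⟩

lemma pathSum_root (tr : ScenarioTree T Node) (x : Node → ℝ) :
    ∑ m ∈ tr.pathSet tr.root, x m = x tr.root := by
  rw [pathSet_root, Finset.sum_singleton]

lemma pathSum_succ (tr : ScenarioTree T Node) (x : Node → ℝ) {n : Node} (hn : n ≠ tr.root) :
    ∑ m ∈ tr.pathSet n, x m = x n + ∑ m ∈ tr.pathSet (tr.parent n), x m := by
  have h : tr.pathSet n = insert n (tr.pathSet (tr.parent n)) := by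
    ext m
    simp only [pathSet, Finset.mem_filter, Finset.mem_univ, true_and, Finset.mem_insert]
    exact tr.onPath_parent_or
  rw [h, Finset.sum_insert]
  simp only [pathSet, Finset.mem_filter, Finset.mem_univ, true_and]
  intro h'
  have := tr.onPath_stage_le h'
  have := tr.parent_stage n hn
  omega

/-- Induction along the tree. -/
lemma tree_ind (tr : ScenarioTree T Node) {p : Node → Prop} (h0 : p tr.root)
    (hs : ∀ n, n ≠ tr.root → p (tr.parent n) → p n) (n : Node) : p n := by
  generalize hk : tr.stage n = k
  induction k generalizing n with
  | zero => have := tr.stage_pos n; omega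
  | succ k ih =>
    by_cases h : n = tr.root
    · rw [h]; exact h0
    · exact hs n h (ih _ (by have := tr.parent_stage n h; omega))

/-- Two nodes merged in the condensed tree. -/
def merged (tr : ScenarioTree T Node) (t : ℕ) (m n : Node) : Prop :=
  tr.stage m = tr.stage n ∧
    (tr.stage m < t ∨ ∃ j, tr.stage j = t ∧ tr.onPath j m ∧ tr.onPath j n)

lemma adaptive_iff (tr : ScenarioTree T Node) (t : ℕ) (x : Node → ℝ) :
    tr.adaptiveConstr t x ↔ ∀ m n, tr.merged t m n → x m = x n := by
  constructor
  · rintro ⟨h1, h2⟩ m n ⟨hs, h | ⟨j, hj, hm, hn⟩⟩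
    · exact h1 m n hs h
    · exact h2 j hj m n hm hn hs
  · intro h
    exact ⟨fun m n hs hl => h m n ⟨hs, Or.inl hl⟩,
      fun j hj m n hm hn hs => h m n ⟨hs, Or.inr ⟨j, hj, hm, hn⟩⟩⟩

lemma merged_root (tr : ScenarioTree T Node) {t : ℕ} {m n : Node} (h : tr.merged t m n) :
    m = tr.root ↔ n = tr.root := by
  constructor
  · rintro rfl; exact tr.root_unique _ (h.1 ▸ tr.stage_root)
  · rintro rfl; exact tr.root_unique _ (h.1.trans tr.stage_root)

lemma merged_parent (tr : ScenarioTree T Node) {t : ℕ} {m n : Node} (h : tr.merged t m n)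
    (hm : m ≠ tr.root) : tr.merged t (tr.parent m) (tr.parent n) := by
  have hn : n ≠ tr.root := fun h' => hm ((tr.merged_root h).2 h')
  have em := tr.parent_stage m hm
  have en := tr.parent_stage n hn
  obtain ⟨hs, h⟩ := h
  refine ⟨by omega, ?_⟩
  rcases h with h | ⟨j, hj, h1, h2⟩
  · left; omega
  · rcases tr.onPath_parent_or.1 h1 with rfl | h1'
    · left; omega
    · rcases tr.onPath_parent_or.1 h2 with rfl | h2'
      · left; omega
      · exact Or.inr ⟨j, hj, h1', h2'⟩

lemma pathSum_merged (tr : ScenarioTree T Node) {t : ℕ} {x : Node → ℝ}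
    (hx : tr.adaptiveConstr t x) (m : Node) : ∀ n, tr.merged t m n →
    ∑ k ∈ tr.pathSet m, x k = ∑ k ∈ tr.pathSet n, x k := by
  rw [adaptive_iff] at hx
  induction m using tr.tree_ind with
  | h0 => intro n h; rw [(tr.merged_root h).1 rfl]
  | hs m hm ih =>
    intro n h
    have hn : n ≠ tr.root := fun h' => hm ((tr.merged_root h).2 h')
    rw [tr.pathSum_succ x hm, tr.pathSum_succ x hn, hx m n h, ih _ (tr.merged_parent h hm)]

lemma exists_ancestor (tr : ScenarioTree T Node) {t : ℕ} (ht : 1 ≤ t) (n : Node) :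
    t ≤ tr.stage n → ∃ j, tr.stage j = t ∧ tr.onPath j n := by
  induction n using tr.tree_ind with
  | h0 => intro h; exact ⟨tr.root, by have := tr.stage_root; omega, 0, rfl⟩
  | hs n hn ih =>
    intro h
    by_cases he : tr.stage n = t
    · exact ⟨n, he, 0, rfl⟩
    · obtain ⟨j, hj, hp⟩ := ih (by have := tr.parent_stage n hn; omega)
      exact ⟨j, hj, tr.onPath_parent_or.2 (Or.inr hp)⟩

/-- the merged demand of the class of `n` -/
lemma exists_condensed (tr : ScenarioTree T Node) (δ : Node → ℝ) {t : ℕ} (ht : 1 ≤ t)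
    (n : Node) : ∃ v ∈ tr.condensedDemands δ t, δ n ≤ v ∧
      ∀ c, (∀ m, tr.merged t m n → δ m ≤ c) → v ≤ c := by
  by_cases h : tr.stage n < t
  · refine ⟨_, Or.inl ⟨tr.stage n, tr.stage_pos n, h, rfl⟩, ?_, ?_⟩
    · exact le_csSup (Set.toFinite _).bddAbove ⟨n, rfl, rfl⟩
    · intro c hc
      refine csSup_le ⟨_, n, rfl, rfl⟩ ?_
      rintro _ ⟨m, hm, rfl⟩
      have hm : tr.stage m = tr.stage n := hm
      exact hc m ⟨hm, Or.inl (by omega)⟩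
  · push Not at h
    obtain ⟨j, hj, hp⟩ := tr.exists_ancestor ht n h
    refine ⟨_, Or.inr ⟨j, hj, tr.stage n, h, tr.stage_le n, rfl⟩, ?_, ?_⟩
    · exact le_csSup (Set.toFinite _).bddAbove ⟨n, ⟨rfl, hp⟩, rfl⟩
    · intro c hc
      refine csSup_le ⟨_, n, ⟨rfl, hp⟩, rfl⟩ ?_
      rintro _ ⟨m, ⟨hm, hpm⟩, rfl⟩
      exact hc m ⟨hm, Or.inr ⟨j, hj, hpm, hp⟩⟩

lemma condGap_nonneg (tr : ScenarioTree T Node) (δ : Node → ℝ) (t : ℕ) :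
    0 ≤ tr.condGap δ t := by
  apply Real.sSup_nonneg
  rintro _ ⟨v, _, rfl⟩
  exact sub_nonneg.2 (Int.le_ceil v)

lemma le_condGap (tr : ScenarioTree T Node) (δ : Node → ℝ) (t : ℕ) {v : ℝ}
    (hv : v ∈ tr.condensedDemands δ t) : (⌈v⌉ : ℝ) - v ≤ tr.condGap δ t := by
  refine le_csSup ⟨1, ?_⟩ ⟨v, hv, rfl⟩
  rintro _ ⟨w, _, rfl⟩
  have := Int.ceil_lt_add_one w
  simp only; linarith

lemma prob_root (tr : ScenarioTree T Node) : tr.prob tr.root = 1 := by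
  have hT : 1 ≤ T := tr.stage_root ▸ tr.stage_le tr.root
  have h := tr.prob_sum_stage 1 le_rfl hT
  have : Finset.univ.filter (fun n => tr.stage n = 1) = {tr.root} := by
    ext n
    simp only [Finset.mem_filter, Finset.mem_univ, true_and, Finset.mem_singleton]
    exact ⟨tr.root_unique n, fun h => h ▸ tr.stage_root⟩
  rwa [this, Finset.sum_singleton] at h

lemma rounding (tr : ScenarioTree T Node) (a δ x : Node → ℝ) {t : ℕ} (ht : 1 ≤ t)
    (hx : tr.lpFeas δ x) (hadp : tr.adaptiveConstr t x) :
    ∃ x', tr.lpFeas δ x' ∧ tr.adaptiveConstr t x' ∧ (∀ n, ∃ z : ℕ, x' n = (z : ℝ)) ∧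
      tr.lpObj a x' ≤ tr.lpObj a x + tr.condGap δ t * a tr.root := by
  set g := tr.condGap δ t with hg
  have hg0 : 0 ≤ g := tr.condGap_nonneg δ t
  set X : Node → ℝ := fun n => (∑ m ∈ tr.pathSet n, x m) + g with hX
  set X' : Node → ℝ := fun n => if n = tr.root then 0 else X (tr.parent n) with hX'
  have hXm : ∀ m n, tr.merged t m n → X m = X n := fun m n h => by
    simp only [hX]; rw [tr.pathSum_merged hadp m n h]
  have hX'm : ∀ m n, tr.merged t m n → X' m = X' n := fun m n h => by
    by_cases hm : m = tr.root
    · simp [hX', hm, (tr.merged_root h).1 hm]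
    · have hn : n ≠ tr.root := fun h' => hm ((tr.merged_root h).2 h')
      simp only [hX', hm, hn, if_false]
      exact hXm _ _ (tr.merged_parent h hm)
  have hle : ∀ n, X' n ≤ X n := by
    intro n
    by_cases hn : n = tr.root
    · simp only [hX', hX, hn, if_true, tr.pathSum_root]
      linarith [hx.1 tr.root]
    · simp only [hX', hX, hn, if_false, tr.pathSum_succ x hn]
      linarith [hx.1 n]
  have hdem : ∀ n, ∃ k : ℤ, δ n ≤ k ∧ (k : ℝ) ≤ X n := by
    intro n
    obtain ⟨v, hv, h1, h2⟩ := tr.exists_condensed δ ht n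
    refine ⟨⌈v⌉, h1.trans (Int.le_ceil v), ?_⟩
    have h3 := tr.le_condGap δ t hv
    have h4 : v ≤ ∑ m ∈ tr.pathSet n, x m := h2 _ fun m hm => by
      rw [← tr.pathSum_merged hadp m n hm]; exact hx.2 m
    simp only [hX]; linarith
  obtain ⟨θ, h0, h1, hθ⟩ := exists_rounding (fun n => tr.prob n * a n) X X'
  set x' : Node → ℝ := fun n => ((⌊X n + θ⌋ : ℤ) : ℝ) - ((⌊X' n + θ⌋ : ℤ) : ℝ) with hx'
  have hnat : ∀ n, ∃ z : ℕ, x' n = (z : ℝ) := by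
    intro n
    have : ⌊X' n + θ⌋ ≤ ⌊X n + θ⌋ := Int.floor_le_floor (by linarith [hle n])
    refine ⟨(⌊X n + θ⌋ - ⌊X' n + θ⌋).toNat, ?_⟩
    have h2 : (((⌊X n + θ⌋ - ⌊X' n + θ⌋).toNat : ℤ) : ℝ) =
      ((⌊X n + θ⌋ - ⌊X' n + θ⌋ : ℤ) : ℝ) := by rw [Int.toNat_of_nonneg (by omega)]
    simp only [hx']
    rw [Int.cast_natCast] at h2
    rw [h2]; push_cast; ring
  have hsum : ∀ n, ∑ m ∈ tr.pathSet n, x' m = ((⌊X n + θ⌋ : ℤ) : ℝ) := by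
    intro n
    induction n using tr.tree_ind with
    | h0 =>
      rw [tr.pathSum_root]
      have : ⌊θ⌋ = 0 := Int.floor_eq_zero_iff.2 ⟨h0, h1⟩
      simp [hx', hX', this]
    | hs n hn ih =>
      rw [tr.pathSum_succ _ hn, ih]
      simp [hx', hX', hn]
  refine ⟨x', ⟨?_, ?_⟩, ?_, hnat, ?_⟩
  · intro n; obtain ⟨z, hz⟩ := hnat n; rw [hz]; positivity
  · intro n
    rw [hsum]
    obtain ⟨k, hk1, hk2⟩ := hdem n
    refine hk1.trans ?_
    exact_mod_cast Int.le_floor.2 (by linarith)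
  · rw [adaptive_iff]
    intro m n h
    simp only [hx', hXm m n h, hX'm m n h]
  · refine hθ.trans (le_of_eq ?_)
    have hd : ∀ n, X n - X' n = x n + if n = tr.root then g else 0 := by
      intro n
      by_cases hn : n = tr.root
      · simp [hX, hX', hn, tr.pathSum_root]
      · simp [hX, hX', hn, tr.pathSum_succ x hn]
    simp only [hd, lpObj, mul_add, Finset.sum_add_distrib, mul_ite, mul_zero,
      Finset.sum_ite_eq', Finset.mem_univ, if_true, tr.prob_root]
    ring

lemma exists_adaptive_int (tr : ScenarioTree T Node) (δ : Node → ℝ) {t : ℕ} :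
    ∃ x, tr.lpFeas δ x ∧ tr.adaptiveConstr t x ∧ (∀ n, ∃ z : ℕ, x n = (z : ℝ)) := by
  obtain ⟨M, hM⟩ := (Set.finite_range δ).bddAbove
  obtain ⟨z, hz⟩ := exists_nat_ge M
  set x : Node → ℝ := fun n => if n = tr.root then (z : ℝ) else 0 with hx
  have hs : ∀ n, ∑ m ∈ tr.pathSet n, x m = z := by
    intro n
    induction n using tr.tree_ind with
    | h0 => rw [tr.pathSum_root]; simp [hx]
    | hs n hn ih => rw [tr.pathSum_succ _ hn, ih]; simp [hx, hn]
  refine ⟨x, ⟨?_, ?_⟩, ?_, ?_⟩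
  · intro n; simp only [hx]; split_ifs <;> positivity
  · intro n; rw [hs]; exact (hM ⟨n, rfl⟩).trans hz
  · rw [adaptive_iff]; intro m n h; simp only [hx, tr.merged_root h]
  · intro n
    by_cases hn : n = tr.root
    · exact ⟨z, by simp [hx, hn]⟩
    · exact ⟨0, by simp [hx, hn]⟩

lemma exists_near (tr : ScenarioTree T Node) (a δ : Node → ℝ) {t : ℕ} (ht : 1 ≤ t)
    {ε : ℝ} (hε : 0 < ε) :
    ∃ x', tr.lpFeas δ x' ∧ tr.adaptiveConstr t x' ∧ (∀ n, ∃ z : ℕ, x' n = (z : ℝ)) ∧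
      tr.lpObj a x' ≤ tr.vR a δ t + tr.condGap δ t * a tr.root + ε := by
  obtain ⟨x0, h1, h2, _⟩ := tr.exists_adaptive_int δ (t := t)
  obtain ⟨_, ⟨x, ⟨hx1, hx2⟩, rfl⟩, hlt⟩ := Real.lt_sInf_add_pos
    (s := tr.lpObj a '' {x | tr.lpFeas δ x ∧ tr.adaptiveConstr t x}) ⟨_, x0, ⟨h1, h2⟩, rfl⟩ hε
  obtain ⟨x', p1, p2, p3, p4⟩ := tr.rounding a δ x ht hx1 hx2
  refine ⟨x', p1, p2, p3, ?_⟩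
  unfold vR
  linarith

lemma vM_le (tr : ScenarioTree T Node) {a δ x : Node → ℝ} (ha : ∀ n, 0 ≤ a n)
    (hx : tr.lpFeas δ x) : tr.vM a δ ≤ tr.lpObj a x := by
  refine csInf_le ⟨0, ?_⟩ ⟨x, hx, rfl⟩
  rintro _ ⟨y, hy, rfl⟩
  exact Finset.sum_nonneg fun n _ =>
    mul_nonneg (mul_nonneg (tr.prob_pos n).le (ha n)) (hy.1 n)

end ScenarioTree

lemma capObj_eq {T : ℕ} {Node : Type} [Fintype Node] [DecidableEq Node] {I J : ℕ}
    (tr : ScenarioTree T Node) (a : Node → Fin I → ℝ) (b : Node → Fin J → ℝ)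
    (x : Node → Fin I → ℝ) (y : Node → Fin J → ℝ) :
    capObj tr a b x y = (∑ i, tr.lpObj (fun n => a n i) (fun n => x n i)) +
      ∑ n, tr.prob n * ∑ j, b n j * y n j := by
  unfold capObj ScenarioTree.lpObj
  rw [Finset.sum_comm, ← Finset.sum_add_distrib]
  refine Finset.sum_congr rfl fun n _ => ?_
  rw [mul_add, Finset.mul_sum]
  simp only [mul_assoc]

lemma capObj_nonneg {T : ℕ} {Node : Type} [Fintype Node] [DecidableEq Node] {I J K : ℕ}
    (tr : ScenarioTree T Node) {a : Node → Fin I → ℝ} {b : Node → Fin J → ℝ}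
    {A : Node → Matrix (Fin I) (Fin J) ℝ} {B : Node → Matrix (Fin K) (Fin J) ℝ}
    {dem : Node → Fin K → ℝ}
    (ha : ∀ n i, 0 ≤ a n i) (hb : ∀ n j, 0 ≤ b n j)
    {x : Node → Fin I → ℝ} {y : Node → Fin J → ℝ} (h : capFeas tr A B dem x y) :
    0 ≤ capObj tr a b x y :=
  Finset.sum_nonneg fun n _ => mul_nonneg (tr.prob_pos n).le
    (add_nonneg (Finset.sum_nonneg fun i _ => mul_nonneg (ha n i) (h.1 n i))
      (Finset.sum_nonneg fun j _ => mul_nonneg (hb n j) (h.2.1 n j)))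

end Helpers

/-- **Corollary 2**: comparison of the adaptive two-stage value under a given revision
vector `t*` with the optimal adaptive two-stage value `V^{ATS}` (revision times
optimized):
`V^{ATS}(t*) − V^{ATS} ≤ ∑_i (v_i^R(t_i*) − v_i^M + max_{n ∈ 𝒯_i(t_i*)}(⌈δ_{in}⌉ − δ_{in}) a_{i1})`,
where `δ_{in} = [A_n y^{MLP}_n]_i` comes from an optimal capacity allocation `y^{MLP}`
of the LP relaxation of the multi-stage problem. -/
theorem VATS_sub_VATSopt_upper_bound
    {T : ℕ} {Node : Type} [Fintype Node] [DecidableEq Node] {I J K : ℕ}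
    (tr : ScenarioTree T Node)
    (a : Node → Fin I → ℝ) (b : Node → Fin J → ℝ)
    (A : Node → Matrix (Fin I) (Fin J) ℝ) (B : Node → Matrix (Fin K) (Fin J) ℝ)
    (dem : Node → Fin K → ℝ)
    (ha : ∀ n i, 0 ≤ a n i) (hb : ∀ n j, 0 ≤ b n j)
    (hA : ∀ n i j, 0 ≤ A n i j) (hB : ∀ n k j, 0 ≤ B n k j)
    (hdem : ∀ n k, 0 ≤ dem n k)
    (xMLP : Node → Fin I → ℝ) (yMLP : Node → Fin J → ℝ)
    (hfeas : capFeas tr A B dem xMLP yMLP)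
    (hopt : capObj tr a b xMLP yMLP =
      sInf {v : ℝ | ∃ x y, capFeas tr A B dem x y ∧ v = capObj tr a b x y})
    (tstar : Fin I → ℕ) (htstar : ∀ i, 1 ≤ tstar i ∧ tstar i ≤ T) :
    VATS tr a b A B dem tstar - VATSopt tr a b A B dem
      ≤ ∑ i : Fin I,
        (tr.vR (fun n => a n i) (fun n => (A n).mulVec (yMLP n) i) (tstar i)
          - tr.vM (fun n => a n i) (fun n => (A n).mulVec (yMLP n) i)
          + tr.condGap (fun n => (A n).mulVec (yMLP n) i) (tstar i) * a tr.root i) := by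
  -- the multi-stage LP value is a lower bound for `V^{ATS}`
  have hlow : capObj tr a b xMLP yMLP ≤ VATSopt tr a b A B dem := by
    unfold VATSopt
    refine le_csInf ⟨_, tstar, htstar, rfl⟩ ?_
    rintro _ ⟨t, ht, rfl⟩
    unfold VATS
    refine le_csInf ?_ ?_
    · choose x h1 h2 h3 using fun i => tr.exists_adaptive_int
        (fun n => (A n).mulVec (yMLP n) i) (t := t i)
      exact ⟨_, fun n i => x i n, yMLP, ⟨fun n i => (h1 i).1 n, hfeas.2.1,
        fun n i => (h1 i).2 n, hfeas.2.2.2⟩, fun n i => h3 i n, fun i => h2 i, rfl⟩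
    · rintro _ ⟨x, y, hf, _, _, rfl⟩
      rw [hopt]
      refine csInf_le ⟨0, ?_⟩ ⟨x, y, hf, rfl⟩
      rintro _ ⟨x, y, hf, rfl⟩
      exact capObj_nonneg tr ha hb hf
  have hM : ∑ i, tr.vM (fun n => a n i) (fun n => (A n).mulVec (yMLP n) i) ≤
      ∑ i, tr.lpObj (fun n => a n i) (fun n => xMLP n i) :=
    Finset.sum_le_sum fun i _ => tr.vM_le (fun n => ha n i)
      ⟨fun n => hfeas.1 n i, fun n => hfeas.2.2.1 n i⟩
  have hup : ∀ ε : ℝ, 0 < ε → VATS tr a b A B dem tstar ≤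
      (∑ i : Fin I, (tr.vR (fun n => a n i) (fun n => (A n).mulVec (yMLP n) i) (tstar i)
        + tr.condGap (fun n => (A n).mulVec (yMLP n) i) (tstar i) * a tr.root i + ε)) +
      ∑ n, tr.prob n * ∑ j, b n j * yMLP n j := by
    intro ε hε
    choose x h1 h2 h3 h4 using fun i => tr.exists_near (fun n => a n i)
      (fun n => (A n).mulVec (yMLP n) i) (htstar i).1 hε
    have hle : VATS tr a b A B dem tstar ≤ capObj tr a b (fun n i => x i n) yMLP := by
      unfold VATS
      refine csInf_le ⟨0, ?_⟩ ⟨fun n i => x i n, yMLP, ⟨fun n i => (h1 i).1 n, hfeas.2.1,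
        fun n i => (h1 i).2 n, hfeas.2.2.2⟩, fun n i => h3 i n, fun i => h2 i, rfl⟩
      rintro _ ⟨x, y, hf, _, _, rfl⟩
      exact capObj_nonneg tr ha hb hf
    rw [capObj_eq] at hle
    refine hle.trans ?_
    gcongr with i
    exact h4 i
  rw [capObj_eq] at hlow
  refine le_of_forall_pos_le_add fun ε hε => ?_
  have h := hup (ε / (I + 1)) (by positivity)
  have hI : (I : ℝ) * (ε / (I + 1)) ≤ ε := by
    rw [mul_div_assoc', div_le_iff₀ (by positivity)]; nlinarith
  simp only [Finset.sum_add_distrib, Finset.sum_sub_distrib, Finset.sum_const, Finset.card_univ,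
    Fintype.card_fin, nsmul_eq_mul] at h ⊢
  linarith

end
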